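/- Let n ≥ 2 be an integer, p ∈ (0,1) and ε > 0 reals, and fix 1 ≤ i ≤ n−1. If X = (X_1,…,X_n) ∈ {0,1}^n has independent coordinates with Pr[X_j = 1] = p for each j, then Pr[ d(X, π_i(X)) ≤ (1−ε)·n·p·(1−p) ] ≤ exp( −(1+ε)²·p²·(1−p)²·n / 2 ). -/

import Mathlib

open Finset

/-- The `i`-th cyclic shift of `x`: coordinate `j` of `cshift i x` is `x_{j+i}`
(indices mod `n`). -/
def cshift {q n : ℕ} (i : ℕ) (x : Fin n → Fin q) : Fin n → Fin q :=
  fun j => x ⟨(j.1 + i) % n, Nat.mod_lt _ j.pos⟩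

open MeasureTheory ProbabilityTheory in
lemma two_point (p s u v c : ℝ) (hp0 : 0 < p) (hp1 : p < 1) (h1 : u - v ≤ c) (h2 : v - u ≤ c) :
    p * Real.exp (s * u) + (1 - p) * Real.exp (s * v) ≤
      Real.exp (s * (p * u + (1 - p) * v) + s ^ 2 * c ^ 2 / 8) := by
  let μ : Measure ℝ := ENNReal.ofReal p • Measure.dirac u + ENNReal.ofReal (1 - p) • Measure.dirac v
  have hμ : IsProbabilityMeasure μ := ⟨by
    simp only [μ, Measure.add_apply, Measure.smul_apply, measure_univ, smul_eq_mul, mul_one]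
    rw [← ENNReal.ofReal_add hp0.le (by linarith)]; simp⟩
  have hint : ∀ f : ℝ → ℝ, ∫ x, f x ∂μ = p * f u + (1 - p) * f v := by
    intro f
    have i1 : ∀ (a : ℝ) (r : ℝ), Integrable f (ENNReal.ofReal r • Measure.dirac a) := fun a r =>
      (integrable_dirac (by simp)).smul_measure (by simp)
    rw [integral_add_measure (i1 _ _) (i1 _ _), integral_smul_measure, integral_smul_measure,
      integral_dirac, integral_dirac, ENNReal.toReal_ofReal hp0.le,
      ENNReal.toReal_ofReal (by linarith)]
    simp
  have h := hasSubgaussianMGF_of_mem_Icc (μ := μ) (X := fun x => x) (a := min u v) (b := max u v)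
    aemeasurable_id (by
      simp only [μ]
      rw [ae_add_measure_iff]
      constructor <;> apply Measure.ae_smul_measure <;> refine (ae_dirac_iff (p := fun x => x ∈ Set.Icc (min u v) (max u v)) measurableSet_Icc).2 ?_ <;> simp)
  have h3 := h.mgf_le s
  rw [mgf, hint, hint] at h3
  have h4 : (max u v - min u v)^2 ≤ c^2 := by
    rw [max_sub_min_eq_abs, sq_abs]
    nlinarith
  set m := p * u + (1 - p) * v with hm
  have e1 : ∀ y, Real.exp (s * y) = Real.exp (s * m) * Real.exp (s * (y - m)) := fun y => by
    rw [← Real.exp_add]; ring_nf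
  rw [e1 u, e1 v, Real.exp_add]
  calc _ = Real.exp (s * m) * (p * Real.exp (s * (u - m)) + (1 - p) * Real.exp (s * (v - m))) := by ring
    _ ≤ _ := by
      refine mul_le_mul_of_nonneg_left (h3.trans (Real.exp_le_exp.2 ?_)) (Real.exp_pos _).le
      simp only [NNReal.coe_pow, NNReal.coe_div, coe_nnnorm, NNReal.coe_ofNat, Real.norm_eq_abs, div_pow, sq_abs]
      nlinarith [mul_le_mul_of_nonneg_left h4 (sq_nonneg s)]

def wt (p : ℝ) (b : Fin 2) : ℝ := if b = 1 then p else 1 - p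

lemma sum_cons {n : ℕ} (f : (Fin (n+1) → Fin 2) → ℝ) :
    ∑ x, f x = ∑ b : Fin 2, ∑ y : Fin n → Fin 2, f (Fin.cons b y) := by
  rw [← Fintype.sum_prod_type', ← (Fin.consEquiv (fun _ : Fin (n+1) => Fin 2)).sum_comp]
  rfl

lemma sum_wt (p : ℝ) (n : ℕ) : ∑ x : Fin n → Fin 2, ∏ j, wt p (x j) = 1 := by
  rw [← Fintype.piFinset_univ, ← Finset.prod_univ_sum]
  simp [wt]

lemma wt_nonneg (p : ℝ) (hp0 : 0 < p) (hp1 : p < 1) (b : Fin 2) : 0 ≤ wt p b := by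
  unfold wt; split_ifs <;> linarith

lemma mcd (p s c : ℝ) (hp0 : 0 < p) (hp1 : p < 1) : ∀ (n : ℕ) (F : (Fin n → Fin 2) → ℝ)
    (_ : ∀ x y k, (∀ j, j ≠ k → x j = y j) → F x - F y ≤ c),
    ∑ x, (∏ j, wt p (x j)) * Real.exp (s * F x) ≤
      Real.exp (s * (∑ x, (∏ j, wt p (x j)) * F x) + n * (s ^ 2 * c ^ 2 / 8)) := by
  intro n
  induction n with
  | zero => intro F _; simp
  | succ n ih =>
    intro F hF
    rw [sum_cons, sum_cons]
    simp only [Fin.prod_univ_succ, Fin.cons_zero, Fin.cons_succ, mul_assoc, ← Finset.mul_sum]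
    set G : Fin 2 → ℝ := fun b => ∑ y : Fin n → Fin 2, (∏ j, wt p (y j)) * F (Fin.cons b y) with hG
    have hb : ∀ b, ∑ y : Fin n → Fin 2, (∏ j, wt p (y j)) * Real.exp (s * F (Fin.cons b y)) ≤
        Real.exp (s * G b + n * (s ^ 2 * c ^ 2 / 8)) := fun b =>
      ih (fun y => F (Fin.cons b y)) (fun x y k h => hF _ _ k.succ (fun j => by
        refine Fin.cases ?_ (fun j => ?_) j
        · simp
        · intro hj; simpa using h j (fun e => hj (by rw [e]))))
    have hd : ∀ b b', G b - G b' ≤ c := by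
      intro b b'
      rw [hG]
      simp only
      rw [← Finset.sum_sub_distrib]
      calc _ ≤ ∑ y : Fin n → Fin 2, (∏ j, wt p (y j)) * c := by
            refine Finset.sum_le_sum fun y _ => ?_
            rw [← mul_sub]
            refine mul_le_mul_of_nonneg_left (hF _ _ 0 fun j => ?_)
              (Finset.prod_nonneg fun j _ => wt_nonneg p hp0 hp1 _)
            refine Fin.cases ?_ (fun j => ?_) j <;> simp
        _ = c := by rw [← Finset.sum_mul, sum_wt, one_mul]
    have ht := two_point p s (G 1) (G 0) c hp0 hp1 (hd _ _) (hd _ _)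
    calc _ ≤ ∑ b, wt p b * Real.exp (s * G b + n * (s ^ 2 * c ^ 2 / 8)) :=
          Finset.sum_le_sum fun b _ => mul_le_mul_of_nonneg_left (hb b) (wt_nonneg p hp0 hp1 _)
      _ = (p * Real.exp (s * G 1) + (1 - p) * Real.exp (s * G 0)) * Real.exp (n * (s ^ 2 * c ^ 2 / 8)) := by
          simp [Fin.sum_univ_two, wt, Real.exp_add]; ring
      _ ≤ _ := mul_le_mul_of_nonneg_right ht (Real.exp_pos _).le
      _ = _ := by
          rw [← Real.exp_add]
          congr 1
          have e : ∑ b : Fin 2, wt p b * G b = p * G 1 + (1 - p) * G 0 := by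
            simp [Fin.sum_univ_two, wt]; ring
          change _ = s * (∑ b : Fin 2, wt p b * G b) + _
          rw [e]; push_cast; ring

lemma exp_one (p : ℝ) (n : ℕ) (S : Finset (Fin n)) :
    ∑ x : Fin n → Fin 2, (∏ j, wt p (x j)) * (∏ j ∈ S, if x j = 1 then (1:ℝ) else 0) = p ^ S.card := by
  have : ∀ x : Fin n → Fin 2, (∏ j, wt p (x j)) * (∏ j ∈ S, if x j = 1 then (1:ℝ) else 0)
      = ∏ j, (wt p (x j) * if j ∈ S then (if x j = 1 then (1:ℝ) else 0) else 1) := by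
    intro x
    rw [Finset.prod_mul_distrib, Finset.prod_ite_mem]; simp
  simp only [this]
  rw [← Fintype.piFinset_univ, ← Finset.prod_univ_sum (fun _ => univ) (fun j b => (wt p b * if j ∈ S then (if b = 1 then (1:ℝ) else 0) else 1))]
  have : ∀ j, ∑ b, (wt p b * if j ∈ S then (if b = 1 then (1:ℝ) else 0) else 1) = if j ∈ S then p else 1 := by
    intro j
    by_cases h : j ∈ S <;> simp [h, wt]
  rw [Finset.prod_congr rfl (fun j _ => this j), Finset.prod_ite_mem]
  simp

lemma exp_ne (p : ℝ) (n : ℕ) (k l : Fin n) (h : k ≠ l) :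
    ∑ x : Fin n → Fin 2, (∏ j, wt p (x j)) * (if x k ≠ x l then (1:ℝ) else 0) = 2 * p * (1 - p) := by
  have h1 := exp_one p n {k}
  have h2 := exp_one p n {l}
  have h3 := exp_one p n {k, l}
  rw [Finset.card_pair h] at h3
  simp only [Finset.prod_pair h, Finset.prod_singleton, Finset.card_singleton] at h1 h2 h3
  have : ∀ a b : Fin 2, (if a ≠ b then (1:ℝ) else 0) = (if a = 1 then (1:ℝ) else 0) + (if b = 1 then (1:ℝ) else 0) - 2 * ((if a = 1 then (1:ℝ) else 0) * (if b = 1 then (1:ℝ) else 0)) := by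
    intro a b
    fin_cases a <;> fin_cases b <;> norm_num
  calc _ = _ := Finset.sum_congr rfl fun x _ => by rw [this, mul_sub, mul_add, mul_left_comm]
    _ = _ := by
      rw [Finset.sum_sub_distrib, Finset.sum_add_distrib, ← Finset.mul_sum, h1, h2, h3]; ring

def sg {n : ℕ} (i : ℕ) (j : Fin n) : Fin n := ⟨(j.1 + i) % n, Nat.mod_lt _ j.pos⟩

lemma sg_inj {n : ℕ} (i : ℕ) : Function.Injective (sg i : Fin n → Fin n) := by
  intro a b h
  have h' : (a.1 + i) ≡ (b.1 + i) [MOD n] := congrArg Fin.val h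
  have := Nat.ModEq.add_right_cancel' i h'
  exact Fin.ext (Nat.ModEq.eq_of_lt_of_lt this a.2 b.2)

lemma sg_ne {n : ℕ} (i : ℕ) (h1 : 1 ≤ i) (h2 : i ≤ n - 1) (j : Fin n) : j ≠ sg i j := by
  intro h
  have h' : j.1 = (j.1 + i) % n := congrArg Fin.val h
  have := j.2
  rcases lt_or_ge (j.1 + i) n with h3 | h3
  · rw [Nat.mod_eq_of_lt h3] at h'; omega
  · rw [Nat.mod_eq_sub_mod h3, Nat.mod_eq_of_lt (by omega)] at h'; omega

lemma hd_eq {n : ℕ} (i : ℕ) (x : Fin n → Fin 2) :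
    (hammingDist x (cshift i x) : ℝ) = ∑ j, if x j ≠ x (sg i j) then (1:ℝ) else 0 := by
  rw [hammingDist, Finset.card_filter, Nat.cast_sum]
  refine Finset.sum_congr rfl fun j _ => ?_
  rw [Nat.cast_ite, Nat.cast_one, Nat.cast_zero]
  rfl

open scoped Classical in
/-- For X with i.i.d. Bernoulli(p) coordinates,
Pr[d(X, π_i(X)) ≤ (1-ε)np(1-p)] ≤ exp(-(1+ε)²p²(1-p)²n/2). -/
theorem stmt14 (n : ℕ) (hn : 2 ≤ n) (p ε : ℝ) (hp : p ∈ Set.Ioo (0 : ℝ) 1) (hε : 0 < ε)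
    (i : ℕ) (hi1 : 1 ≤ i) (hi2 : i ≤ n - 1) :
    ∑ x ∈ Finset.univ.filter fun x : Fin n → Fin 2 =>
        (hammingDist x (cshift i x) : ℝ) ≤ (1 - ε) * n * p * (1 - p),
      (∏ j : Fin n, if x j = 1 then p else 1 - p) ≤
      Real.exp (-((1 + ε) ^ 2 * p ^ 2 * (1 - p) ^ 2 * n) / 2) := by
  obtain ⟨hp0, hp1⟩ := hp
  have hw : ∀ x : Fin n → Fin 2, (∏ j : Fin n, if x j = 1 then p else 1 - p) = ∏ j, wt p (x j) :=
    fun x => by simp [wt]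
  simp only [hw]
  set F : (Fin n → Fin 2) → ℝ := fun x => ∑ j, if x j ≠ x (sg i j) then (1:ℝ) else 0 with hF
  have hFd : ∀ x : Fin n → Fin 2, (hammingDist x (cshift i x) : ℝ) = F x := fun x => hd_eq i x
  simp only [hFd]
  have hE : ∑ x, (∏ j, wt p (x j)) * F x = n * (2 * p * (1 - p)) := by
    simp only [hF, Finset.mul_sum]
    rw [Finset.sum_comm]
    rw [Finset.sum_congr rfl (fun j _ => exp_ne p n j (sg i j) (sg_ne i hi1 hi2 j))]
    simp
  have hbd : ∀ x y k, (∀ j, j ≠ k → x j = y j) → F x - F y ≤ 2 := by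
    intro x y k h
    simp only [hF]
    rw [← Finset.sum_sub_distrib]
    calc _ ≤ ∑ j, ((if j = k then (1:ℝ) else 0) + (if sg i j = k then (1:ℝ) else 0)) := by
          refine Finset.sum_le_sum fun j _ => ?_
          by_cases h1 : j = k
          · split_ifs <;> norm_num
          · by_cases h2 : sg i j = k
            · split_ifs <;> norm_num
            · rw [h j h1, h _ h2]; simp [h1, h2]
      _ ≤ 2 := by
          rw [Finset.sum_add_distrib]
          have : ∑ j, (if sg i j = k then (1:ℝ) else 0) ≤ 1 := by
            rw [← Finset.sum_filter, Finset.sum_const, nsmul_eq_mul, mul_one]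
            exact_mod_cast Finset.card_le_one.2 (fun a ha b hb => sg_inj i (by simp at ha hb; rw [ha, hb]))
          simp only [Finset.sum_ite_eq', Finset.mem_univ, if_true]
          linarith
  have hq : 0 < p * (1 - p) := mul_pos hp0 (by linarith)
  set s : ℝ := -((1 + ε) * (p * (1 - p))) with hs
  have hs0 : s ≤ 0 := by rw [hs]; have := mul_pos (by linarith : 0 < 1 + ε) hq; linarith
  have hm := mcd p s 2 hp0 hp1 n F hbd
  rw [hE] at hm
  set T : ℝ := (1 - ε) * n * p * (1 - p) with hT
  have hwn : ∀ x : Fin n → Fin 2, 0 ≤ ∏ j, wt p (x j) := fun x =>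
    Finset.prod_nonneg fun j _ => wt_nonneg p hp0 hp1 _
  calc _ ≤ ∑ x ∈ Finset.univ.filter (fun x => F x ≤ T), (∏ j, wt p (x j)) * Real.exp (s * F x) * Real.exp (-(s * T)) := by
        refine Finset.sum_le_sum fun x hx => ?_
        have hx' : F x ≤ T := by simpa using hx
        rw [mul_assoc, ← Real.exp_add]
        refine le_mul_of_one_le_right (hwn x) (Real.one_le_exp ?_)
        nlinarith
    _ ≤ ∑ x, (∏ j, wt p (x j)) * Real.exp (s * F x) * Real.exp (-(s * T)) :=
        Finset.sum_le_sum_of_subset_of_nonneg (Finset.filter_subset _ _) fun x _ _ =>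
          mul_nonneg (mul_nonneg (hwn x) (Real.exp_pos _).le) (Real.exp_pos _).le
    _ ≤ _ := by
        rw [← Finset.sum_mul]
        refine (mul_le_mul_of_nonneg_right hm (Real.exp_pos _).le).trans (le_of_eq ?_)
        rw [← Real.exp_add, hT, hs]
        congr 1
        ring
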